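/- arXiv:2406.00643 — 3 statements merged into one kernel-verified Lean document; each statement's English description precedes it below -/
import Mathlib

section
/- Let G be a finite simple graph and k ≥ 1 an integer. Then Γ(G) ≥ k if and only if there exists a vertex u of G such that the induced subgraph G[B(u, k−1)] admits a Grundy coloring in which u receives color k (equivalently, Γ_{G[B(u,k−1)]}(u) ≥ k). -/
open SimpleGraph

variable {V : Type*}

/-- A Grundy (First-Fit) coloring of `G` with `k` colors: a proper coloring with colors
`1, …, k`, all color classes nonempty, such that every vertex of color `j` has a neighbor
of each color `i < j` (with `i ≥ 1`). -/
def IsGrundyColoring (G : SimpleGraph V) (c : V → ℕ) (k : ℕ) : Prop :=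
  (∀ v, c v ∈ Finset.Icc 1 k) ∧
  (∀ ⦃x y⦄, G.Adj x y → c x ≠ c y) ∧
  (∀ i ∈ Finset.Icc 1 k, ∃ v, c v = i) ∧
  (∀ v, ∀ i ∈ Finset.Ico 1 (c v), ∃ w, G.Adj v w ∧ c w = i)

/-- The Grundy (First-Fit) chromatic number `Γ(G)`. -/
noncomputable def grundyNumber (G : SimpleGraph V) : ℕ :=
  sSup {k | ∃ c, IsGrundyColoring G c k}

/-- `Γ_G(u)`: the largest color that `u` can receive in a Grundy coloring of `G`. -/
noncomputable def grundyAt (G : SimpleGraph V) (u : V) : ℕ :=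
  sSup {j | ∃ c k, IsGrundyColoring G c k ∧ c u = j}

/-- `v` is a cut-vertex of `G`: deleting `v` disconnects (for connected `G`, increases the
number of connected components). -/
def IsCutVertex (G : SimpleGraph V) (v : V) : Prop :=
  ¬ (G.induce {w | w ≠ v}).Connected

/-- A block of `G`: a maximal vertex set of size at least two inducing a connected subgraph
with no cut-vertex (i.e. a maximal 2-connected subgraph or a bridge with its endpoints). -/
def IsBlock (G : SimpleGraph V) (B : Set V) : Prop :=
  Maximal (fun A : Set V => 2 ≤ A.ncard ∧ (G.induce A).Connected ∧
    ∀ v ∈ A, (G.induce (A \ {v})).Connected) B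

/-- A block graph: a connected graph every block of which is complete. -/
def IsBlockGraph (G : SimpleGraph V) : Prop :=
  G.Connected ∧ ∀ B : Set V, IsBlock G B → ∀ u ∈ B, ∀ v ∈ B, u ≠ v → G.Adj u v

/-- The number of blocks of `G` containing `v` (the degree of a cut-vertex `v` in the
block-cutpoint graph). -/
noncomputable def blockDegree (G : SimpleGraph V) (v : V) : ℕ :=
  {B : Set V | IsBlock G B ∧ v ∈ B}.ncard

/-- `Δ̃(G)`: the maximum over all cut-vertices `v` of the number of blocks containing `v`. -/
noncomputable def maxCutBlockDegree (G : SimpleGraph V) : ℕ :=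
  sSup {n | ∃ v, IsCutVertex G v ∧ blockDegree G v = n}

/-- The ball `B(u, r)` of radius `r` centered at `u`. -/
def gball (G : SimpleGraph V) (u : V) (r : ℕ) : Set V :=
  {v | G.Reachable u v ∧ G.dist u v ≤ r}

lemma mem_gball_self (G : SimpleGraph V) (u : V) (r : ℕ) : u ∈ gball G u r :=
  ⟨Reachable.refl u, by simp [SimpleGraph.dist_self]⟩

/-- The degree of a vertex. -/
noncomputable def deg (G : SimpleGraph V) (v : V) : ℕ := (G.neighborSet v).ncard

/-- `Δ(u) = max {d(v) : v ∈ N(u), d(v) ≤ d(u)}`, equal to `0` if no such neighbor exists. -/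
noncomputable def maxSmallNbrDeg (G : SimpleGraph V) (u : V) : ℕ :=
  sSup {d | ∃ v, G.Adj u v ∧ deg G v ≤ deg G u ∧ deg G v = d}

/-- `Δ₂(G) = max_{u} Δ(u)`. -/
noncomputable def delta2 (G : SimpleGraph V) : ℕ :=
  sSup {d | ∃ u, maxSmallNbrDeg G u = d}

/-- The maximum number of vertices of a block of `G`. -/
noncomputable def maxBlockSize (G : SimpleGraph V) : ℕ :=
  sSup {n | ∃ B, IsBlock G B ∧ B.ncard = n}

/-- A partial Grundy coloring, defined on the set `S`. -/
def PartG {W : Type*} (G : SimpleGraph W) (S : Set W) (c : W → ℕ) : Prop :=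
  (∀ v ∈ S, 1 ≤ c v) ∧ (∀ x ∈ S, ∀ y ∈ S, G.Adj x y → c x ≠ c y) ∧
  (∀ v ∈ S, ∀ i, 1 ≤ i → i < c v → ∃ w ∈ S, G.Adj v w ∧ c w = i)

lemma partG_extend {W : Type*} [Finite W] (G : SimpleGraph W) (n : ℕ) :
    ∀ (S : Set W) (c : W → ℕ), Sᶜ.ncard = n → PartG G S c →
      ∃ c', PartG G Set.univ c' ∧ ∀ v ∈ S, c' v = c v := by
  classical
  induction n with
  | zero =>
    intro S c hn h
    have : S = Set.univ := by
      rw [Set.ncard_eq_zero] at hn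
      exact Set.compl_empty_iff.mp hn
    subst this
    exact ⟨c, h, fun _ _ => rfl⟩
  | succ n ih =>
    intro S c hn h
    obtain ⟨v, hv⟩ : (Sᶜ).Nonempty := by
      rw [← Set.ncard_pos]; omega
    have hv' : v ∉ S := hv
    have hex : ∃ m, 1 ≤ m ∧ ∀ w ∈ S, G.Adj v w → c w ≠ m := by
      obtain ⟨M, hM⟩ := (Set.finite_range c).bddAbove
      refine ⟨M + 1, by omega, fun w _ _ hw => ?_⟩
      have := hM ⟨w, rfl⟩
      omega
    obtain ⟨m, ⟨hm1, hm2⟩, hmin⟩ : ∃ m, (1 ≤ m ∧ ∀ w ∈ S, G.Adj v w → c w ≠ m) ∧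
        ∀ i < m, ¬ (1 ≤ i ∧ ∀ w ∈ S, G.Adj v w → c w ≠ i) :=
      ⟨Nat.find hex, Nat.find_spec hex, fun _ hi => Nat.find_min hex hi⟩
    have hne : ∀ x ∈ S, x ≠ v := fun x hx e => hv' (e ▸ hx)
    obtain ⟨c', hc', hS⟩ := ih (insert v S) (Function.update c v m) (by
      have h1 : (insert v S)ᶜ = Sᶜ \ {v} := by
        ext x; simp [and_comm]
      rw [h1, Set.ncard_sdiff_singleton_of_mem hv, hn]; rfl) (by
      refine ⟨?_, ?_, ?_⟩
      · rintro x (rfl | hx)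
        · simpa using hm1
        · simpa [hne x hx] using h.1 x hx
      · rintro x (rfl | hx) y (rfl | hy) hxy
        · exact absurd hxy (G.loopless.irrefl _)
        · simpa [hne y hy] using (hm2 y hy hxy).symm
        · simpa [hne x hx] using hm2 x hx hxy.symm
        · simpa [hne x hx, hne y hy] using h.2.1 x hx y hy hxy
      · rintro x (rfl | hx) i hi hlt
        · have hlt' : i < m := by simpa using hlt
          have := hmin i hlt'
          push Not at this
          obtain ⟨w, hw, hadj, hcw⟩ := this hi
          exact ⟨w, Or.inr hw, hadj, by simpa [hne w hw] using hcw⟩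
        · have hlt' : i < c x := by simpa [hne x hx] using hlt
          obtain ⟨w, hw, hadj, hcw⟩ := h.2.2 x hx i hi hlt'
          exact ⟨w, Or.inr hw, hadj, by simpa [hne w hw] using hcw⟩)
    refine ⟨c', hc', fun x hx => ?_⟩
    rw [hS x (Or.inr hx)]
    simp [hne x hx]

lemma partG_isGrundy {W : Type*} [Finite W] (G : SimpleGraph W) (c : W → ℕ)
    (h : PartG G Set.univ c) (u : W) : ∃ k, IsGrundyColoring G c k ∧ c u ≤ k := by
  have : Nonempty W := ⟨u⟩
  obtain ⟨m, hm⟩ := Finite.exists_max c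
  refine ⟨c m, ⟨?_, ?_, ?_, ?_⟩, hm u⟩
  · intro v
    exact Finset.mem_Icc.2 ⟨h.1 v trivial, hm v⟩
  · intro x y hxy
    exact h.2.1 x trivial y trivial hxy
  · intro i hi
    obtain ⟨h1, h2⟩ := Finset.mem_Icc.1 hi
    rcases h2.eq_or_lt with h2 | h2
    · exact ⟨m, h2.symm⟩
    · obtain ⟨w, _, _, hw⟩ := h.2.2 m trivial i h1 h2
      exact ⟨w, hw⟩
  · intro v i hi
    obtain ⟨h1, h2⟩ := Finset.mem_Ico.1 hi
    obtain ⟨w, _, ha, hw⟩ := h.2.2 v trivial i h1 h2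
    exact ⟨w, ha, hw⟩

lemma grundy_le_card {W : Type*} [Finite W] (G : SimpleGraph W) (c : W → ℕ) (k : ℕ)
    (h : IsGrundyColoring G c k) : k ≤ Nat.card W := by
  classical
  have := Fintype.ofFinite W
  have h1 : Finset.Icc 1 k ⊆ Finset.univ.image c := by
    intro i hi
    obtain ⟨v, hv⟩ := h.2.2.1 i hi
    exact Finset.mem_image.2 ⟨v, Finset.mem_univ _, hv⟩
  have h2 := (Finset.card_le_card h1).trans Finset.card_image_le
  simpa [Nat.card_eq_fintype_card] using h2

lemma bdd_number {W : Type*} [Finite W] (G : SimpleGraph W) :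
    BddAbove {k | ∃ c, IsGrundyColoring G c k} :=
  ⟨Nat.card W, by rintro k ⟨c, h⟩; exact grundy_le_card G c k h⟩

lemma bdd_at {W : Type*} [Finite W] (G : SimpleGraph W) (u : W) :
    BddAbove {j | ∃ c k, IsGrundyColoring G c k ∧ c u = j} :=
  ⟨Nat.card W, by
    rintro j ⟨c, k, h, rfl⟩
    exact (Finset.mem_Icc.1 (h.1 u)).2.trans (grundy_le_card G c k h)⟩

lemma exists_of_le_sSup {s : Set ℕ} {k : ℕ} (hk : 1 ≤ k) (hb : BddAbove s) (h : k ≤ sSup s) :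
    ∃ m ∈ s, k ≤ m := by
  have hne : s.Nonempty := by
    by_contra hs
    rw [Set.not_nonempty_iff_eq_empty] at hs
    subst hs
    simp at h
    omega
  exact ⟨sSup s, Nat.sSup_mem hne hb, h⟩

/-- `Γ(G) ≥ k` iff some vertex `u` receives color `k` in a Grundy coloring
of the induced ball `G[B(u, k−1)]`, i.e. `Γ_{G[B(u,k−1)]}(u) ≥ k`. -/
theorem statement_13 [Fintype V] (G : SimpleGraph V) (k : ℕ) (hk : 1 ≤ k) :
    k ≤ grundyNumber G ↔
      ∃ u : V, k ≤ grundyAt (G.induce (gball G u (k - 1))) ⟨u, mem_gball_self G u _⟩ := by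
  classical
  constructor
  · intro h
    obtain ⟨m, ⟨c, hc⟩, hkm⟩ := exists_of_le_sSup hk (bdd_number G) h
    obtain ⟨u, hu⟩ := hc.2.2.1 k (Finset.mem_Icc.2 ⟨hk, hkm⟩)
    refine ⟨u, ?_⟩
    obtain ⟨c', hc', hS⟩ := partG_extend (G.induce (gball G u (k - 1))) _
      {x | c x.1 + G.dist u x.1 ≤ k} (fun x => c x.1) rfl (by
        refine ⟨fun v _ => (Finset.mem_Icc.1 (hc.1 v.1)).1, fun x _ y _ hxy => hc.2.1 hxy, ?_⟩
        intro v hv i hi hlt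
        obtain ⟨w, hadj, hw⟩ := hc.2.2.2 v.1 i (Finset.mem_Ico.2 ⟨hi, hlt⟩)
        have hr : G.Reachable u w := v.2.1.trans hadj.reachable
        have hd : G.dist u w ≤ G.dist u v.1 + 1 := by
          obtain ⟨p, hp⟩ := v.2.1.exists_walk_length_eq_dist
          have := SimpleGraph.dist_le (p.concat hadj)
          rw [SimpleGraph.Walk.length_concat] at this
          omega
        have hv' : c v.1 + G.dist u v.1 ≤ k := hv
        have hlt' : i < c v.1 := hlt
        refine ⟨⟨w, hr, by omega⟩, ?_, hadj, hw⟩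
        change c w + G.dist u w ≤ k
        omega)
    obtain ⟨K, hK, _⟩ := partG_isGrundy _ c' hc' ⟨u, mem_gball_self G u _⟩
    refine le_csSup (bdd_at _ _) ⟨c', K, hK, ?_⟩
    rw [hS _ (by simp [hu])]
    exact hu
  · rintro ⟨u, h⟩
    obtain ⟨m, ⟨c, K, hc, hcu⟩, hkm⟩ := exists_of_le_sSup hk (bdd_at _ _) h
    let f : V → ℕ := fun v => if hv : v ∈ (gball G u (k - 1)) then c ⟨v, hv⟩ else 0
    have hf : ∀ v (hv : v ∈ (gball G u (k - 1))), f v = c ⟨v, hv⟩ := fun v hv => by simp [f, hv]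
    obtain ⟨c', hc', hS⟩ := partG_extend G _ (gball G u (k - 1)) f rfl (by
      refine ⟨?_, ?_, ?_⟩
      · intro v hv
        rw [hf v hv]
        exact (Finset.mem_Icc.1 (hc.1 _)).1
      · intro x hx y hy hxy
        rw [hf x hx, hf y hy]
        exact hc.2.1 hxy
      · intro v hv i hi hlt
        rw [hf v hv] at hlt
        obtain ⟨w, hadj, hw⟩ := hc.2.2.2 ⟨v, hv⟩ i (Finset.mem_Ico.2 ⟨hi, hlt⟩)
        exact ⟨w.1, w.2, hadj, by rw [hf w.1 w.2]; exact hw⟩)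
    obtain ⟨K', hK', hle⟩ := partG_isGrundy G c' hc' u
    have hu : u ∈ (gball G u (k - 1)) := mem_gball_self G u _
    rw [hS u hu, hf u hu, hcu] at hle
    exact (hkm.trans hle).trans (le_csSup (bdd_number G) ⟨c', hK'⟩)
end

section
/- Let G be a finite simple graph, let F be a maximal independent set of vertices of G, let w be a vertex with w ∉ F, and let H = G − F be the subgraph of G induced by V(G) \ F. Then Γ_G(w) ≥ Γ_H(w) + 1. -/
open SimpleGraph

variable {V : Type*}

lemma exists_k_of_greedy {W : Type*} [Fintype W] (G : SimpleGraph W) (c : W → ℕ) (u : W)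
    (h1 : ∀ v, 1 ≤ c v) (h2 : ∀ ⦃x y⦄, G.Adj x y → c x ≠ c y)
    (h3 : ∀ v, ∀ i ∈ Finset.Ico 1 (c v), ∃ w, G.Adj v w ∧ c w = i) :
    ∃ k, IsGrundyColoring G c k := by
  obtain ⟨m, -, hm⟩ := Finset.exists_max_image Finset.univ c ⟨u, Finset.mem_univ u⟩
  refine ⟨c m, fun v => Finset.mem_Icc.2 ⟨h1 v, hm v (Finset.mem_univ v)⟩, h2, ?_, h3⟩
  intro i hi
  rw [Finset.mem_Icc] at hi
  rcases hi.2.eq_or_lt with h | h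
  · exact ⟨m, h.symm⟩
  · obtain ⟨x, -, hx⟩ := h3 m i (Finset.mem_Ico.2 ⟨hi.1, h⟩)
    exact ⟨x, hx⟩

lemma exists_grundy {W : Type*} [Fintype W] (G : SimpleGraph W) (u : W) :
    ∃ c k, IsGrundyColoring G c k := by
  classical
  let P : ℕ → Prop := fun n => ∃ c : W → ℕ, (∀ v, 1 ≤ c v) ∧
    (∀ ⦃x y⦄, G.Adj x y → c x ≠ c y) ∧ ∑ v, c v = n
  have hP : ∃ n, P n := by
    refine ⟨_, fun v => (Fintype.equivFin W v : ℕ) + 1, fun v => by simp, ?_, rfl⟩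
    intro x y hxy h
    apply hxy.ne
    apply (Fintype.equivFin W).injective
    apply Fin.ext
    simpa using h
  obtain ⟨c, h1, h2, h4⟩ := Nat.find_spec hP
  refine ⟨c, exists_k_of_greedy G c u h1 h2 ?_⟩
  intro v i hi
  rw [Finset.mem_Ico] at hi
  by_contra hcon
  push Not at hcon
  have hlt : ∑ x, Function.update c v i x < Nat.find hP := by
    rw [← h4]
    apply Finset.sum_lt_sum
    · intro x _
      by_cases hx : x = v
      · subst hx; simp [hi.2.le]
      · simp [hx]
    · exact ⟨v, Finset.mem_univ v, by simpa using hi.2⟩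
  refine Nat.find_min hP hlt ⟨_, ?_, ?_, rfl⟩
  · intro x
    by_cases hx : x = v
    · subst hx; simp [hi.1]
    · simp [hx, h1]
  · intro x y hxy
    by_cases hx : x = v
    · subst hx
      simpa [hxy.ne'] using (hcon y hxy).symm
    · by_cases hy : y = v
      · subst hy
        simpa [hx] using hcon x hxy.symm
      · simpa [hx, hy] using h2 hxy

lemma grundyAt_bdd {W : Type*} [Fintype W] (G : SimpleGraph W) (u : W) :
    BddAbove {j | ∃ c k, IsGrundyColoring G c k ∧ c u = j} := by
  classical
  refine ⟨Fintype.card W, ?_⟩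
  rintro j ⟨c, k, ⟨h1, -, h3, -⟩, rfl⟩
  have hs : Finset.Icc 1 k ⊆ Finset.univ.image c := by
    intro i hi
    obtain ⟨v, hv⟩ := h3 i hi
    exact Finset.mem_image.2 ⟨v, Finset.mem_univ v, hv⟩
  have := (Finset.card_le_card hs).trans Finset.card_image_le
  have h := (Finset.mem_Icc.1 (h1 u)).2
  simp at this
  exact h.trans this

/-- If `F` is a maximal independent set of `G` and `w ∉ F`, then
`Γ_G(w) ≥ Γ_{G − F}(w) + 1`. -/
theorem statement_15 [Fintype V] (G : SimpleGraph V) (F : Set V)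
    (hF : Maximal (fun A : Set V => A.Pairwise fun x y => ¬ G.Adj x y) F)
    (w : V) (hw : w ∉ F) :
    grundyAt (G.induce Fᶜ) ⟨w, hw⟩ + 1 ≤ grundyAt G w := by
  classical
  have hdom : ∀ v, v ∉ F → ∃ x ∈ F, G.Adj v x := by
    intro v hv
    by_contra hcon
    push Not at hcon
    have hins : (insert v F).Pairwise fun x y => ¬ G.Adj x y := by
      refine Set.Pairwise.insert hF.prop ?_
      intro b hb _
      exact ⟨hcon b hb, fun h => hcon b hb h.symm⟩
    exact hv (hF.le_of_ge hins (Set.subset_insert v F) (Set.mem_insert v F))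
  obtain ⟨c0, k0, h0⟩ := exists_grundy (G.induce Fᶜ) ⟨w, hw⟩
  obtain ⟨c, k, ⟨h1, h2, -, h4⟩, hcw⟩ :=
    Nat.sSup_mem (s := {j | ∃ c k, IsGrundyColoring (G.induce Fᶜ) c k ∧ c ⟨w, hw⟩ = j})
      ⟨c0 ⟨w, hw⟩, c0, k0, h0, rfl⟩ (grundyAt_bdd (G.induce Fᶜ) ⟨w, hw⟩)
  let d : V → ℕ := fun v => if h : v ∈ F then 1 else c ⟨v, h⟩ + 1
  have dF : ∀ v, v ∈ F → d v = 1 := fun v h => by simp [d, h]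
  have dN : ∀ v (h : v ∉ F), d v = c ⟨v, h⟩ + 1 := fun v h => by simp [d, h]
  have cpos : ∀ x, 1 ≤ c x := fun x => (Finset.mem_Icc.1 (h1 x)).1
  obtain ⟨k', hk'⟩ := exists_k_of_greedy G d w
    (by
      intro v
      by_cases h : v ∈ F
      · rw [dF v h]
      · rw [dN v h]; omega)
    (by
      intro x y hxy
      by_cases hx : x ∈ F <;> by_cases hy : y ∈ F
      · exact absurd hxy (hF.prop hx hy hxy.ne)
      · rw [dF x hx, dN y hy]; have := cpos ⟨y, hy⟩; omega
      · rw [dN x hx, dF y hy]; have := cpos ⟨x, hx⟩; omega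
      · rw [dN x hx, dN y hy]
        have : c ⟨x, hx⟩ ≠ c ⟨y, hy⟩ := h2 (by simpa using hxy)
        omega)
    (by
      intro v i hi
      rw [Finset.mem_Ico] at hi
      by_cases h : v ∈ F
      · rw [dF v h] at hi; omega
      · rw [dN v h] at hi
        by_cases hi1 : i = 1
        · obtain ⟨x, hx, hvx⟩ := hdom v h
          exact ⟨x, hvx, by rw [dF x hx, hi1]⟩
        · obtain ⟨⟨x, hx⟩, hvx, hcx⟩ := h4 ⟨v, h⟩ (i - 1) (Finset.mem_Ico.2 (by omega))
          exact ⟨x, by simpa using hvx, by rw [dN x hx, hcx]; omega⟩)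
  refine le_csSup (grundyAt_bdd G w) ⟨d, k', hk', ?_⟩
  rw [dN w hw, hcw]
  rfl
end

section
/- Let G be a finite simple graph in which every cycle has length at least 2·Δ₂(G) + 1, let u be a vertex of G, let G(u) = G[B(u, Δ(u))], and let T be a spanning tree of G(u), rooted at u, such that d_T(u,v) = d_{G(u)}(u,v) for every vertex v of G(u) (a breadth-first search tree of G(u) rooted at u). Then Γ_{G(u)}(u) = Γ_T(u). -/
open SimpleGraph

variable {V : Type*}

/-- A partial Grundy coloring on a vertex set extends to a full one. -/
lemma extend_grundy {X : Type*} [Fintype X] (B : SimpleGraph X) (n : ℕ) :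
    ∀ (W : Set X) (c : X → ℕ), Wᶜ.ncard = n →
      (∀ v ∈ W, 1 ≤ c v) →
      (∀ x ∈ W, ∀ y ∈ W, B.Adj x y → c x ≠ c y) →
      (∀ v ∈ W, ∀ i, 1 ≤ i → i < c v → ∃ w ∈ W, B.Adj v w ∧ c w = i) →
      ∃ c' k, IsGrundyColoring B c' k ∧ ∀ v ∈ W, c' v = c v := by
  classical
  induction n with
  | zero =>
    intro W c hn h1 h2 h3
    have hW : ∀ v, v ∈ W := by
      intro v
      have := (Set.ncard_eq_zero (Set.toFinite _)).1 hn
      by_contra hv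
      have : v ∈ Wᶜ := hv
      simp_all
    refine ⟨c, Finset.univ.sup c, ⟨?_, ?_, ?_, ?_⟩, fun _ _ => rfl⟩
    · intro v
      exact Finset.mem_Icc.2 ⟨h1 v (hW v), Finset.le_sup (f := c) (Finset.mem_univ v)⟩
    · intro x y hxy
      exact h2 x (hW x) y (hW y) hxy
    · intro i hi
      obtain ⟨hi1, hi2⟩ := Finset.mem_Icc.1 hi
      have hne : (Finset.univ : Finset X).Nonempty := by
        by_contra hne
        rw [Finset.not_nonempty_iff_eq_empty] at hne
        rw [hne] at hi2
        simp at hi2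
        omega
      obtain ⟨v, -, hv⟩ := Finset.exists_mem_eq_sup _ hne c
      rw [hv] at hi2
      rcases hi2.eq_or_lt with h | h
      · exact ⟨v, h.symm⟩
      · obtain ⟨w, -, -, hw⟩ := h3 v (hW v) i hi1 h
        exact ⟨w, hw⟩
    · intro v i hi
      obtain ⟨hi1, hi2⟩ := Finset.mem_Ico.1 hi
      obtain ⟨w, -, hw⟩ := h3 v (hW v) i hi1 hi2
      exact ⟨w, hw⟩
  | succ n ih =>
    intro W c hn h1 h2 h3
    obtain ⟨x, hx⟩ : (Wᶜ).Nonempty := by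
      rw [← Set.ncard_pos (Set.toFinite _)]; omega
    have hxW : x ∉ W := hx
    have hex : ∃ m, 1 ≤ m ∧ ∀ w ∈ W, B.Adj x w → c w ≠ m := by
      refine ⟨Finset.univ.sup c + 1, by omega, fun w _ _ => ?_⟩
      have := Finset.le_sup (f := c) (Finset.mem_univ w)
      omega
    obtain ⟨hm1, hm2⟩ := Nat.find_spec hex
    have hmin := fun i (hi : i < Nat.find hex) => Nat.find_min hex hi
    set m := Nat.find hex
    have hne : ∀ v ∈ W, v ≠ x := fun v hv h => hxW (h ▸ hv)
    suffices H : ∃ c' k, IsGrundyColoring B c' k ∧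
        ∀ v ∈ insert x W, c' v = Function.update c x m v by
      obtain ⟨c', k, hc, hcc⟩ := H
      refine ⟨c', k, hc, fun v hv => ?_⟩
      rw [hcc v (Or.inr hv), Function.update_of_ne (hne v hv)]
    apply ih (insert x W) (Function.update c x m)
    · have : (insert x W)ᶜ = Wᶜ \ {x} := by
        ext y; simp [not_or, and_comm]
      rw [this, Set.ncard_diff_singleton_of_mem hx]; omega
    · rintro v (rfl | hv)
      · simpa using hm1
      · rw [Function.update_of_ne (hne v hv)]; exact h1 v hv
    · rintro a (rfl | ha) b (rfl | hb) hab
      · exact absurd hab (B.irrefl)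
      · rw [Function.update_of_ne (hne b hb), Function.update_self]
        exact (hm2 b hb hab).symm
      · rw [Function.update_of_ne (hne a ha), Function.update_self]
        exact hm2 a ha hab.symm
      · rw [Function.update_of_ne (hne a ha), Function.update_of_ne (hne b hb)]
        exact h2 a ha b hb hab
    · rintro v (rfl | hv) i hi1 hi2
      · rw [Function.update_self] at hi2
        have := hmin i hi2
        push Not at this
        obtain ⟨w, hw, hadj, hcw⟩ := this hi1
        exact ⟨w, Or.inr hw, hadj, by rw [Function.update_of_ne (hne w hw)]; exact hcw⟩
      · rw [Function.update_of_ne (hne v hv)] at hi2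
        obtain ⟨w, hw, hadj, hcw⟩ := h3 v hv i hi1 hi2
        exact ⟨w, Or.inr hw, hadj, by rw [Function.update_of_ne (hne w hw)]; exact hcw⟩

/-- Transfer of a Grundy coloring between two graphs which only differ at the last level. -/
lemma transfer_grundy {X : Type*} [Fintype X] (A B : SimpleGraph X) (d : X → ℕ) (r : ℕ) (u : X)
    (hu : d u = 0) (hd : ∀ x y, A.Adj x y → d y ≤ d x + 1)
    (hAB : ∀ x y, ¬ (d x = r ∧ d y = r) → (A.Adj x y ↔ B.Adj x y))
    (c : X → ℕ) (k : ℕ) (hc : IsGrundyColoring A c k) (hj : c u ≤ r + 1) :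
    ∃ c' k', IsGrundyColoring B c' k' ∧ c' u = c u := by
  obtain ⟨h1, h2, -, h4⟩ := hc
  have h4' : ∀ v i, ∃ w, i ∈ Finset.Ico 1 (c v) → A.Adj v w ∧ c w = i := by
    intro v i
    by_cases h : i ∈ Finset.Ico 1 (c v)
    · obtain ⟨w, hw⟩ := h4 v i h
      exact ⟨w, fun _ => hw⟩
    · exact ⟨v, fun h' => absurd h' h⟩
  choose w hw using h4'
  have hpos : ∀ v, 1 ≤ c v := fun v => (Finset.mem_Icc.1 (h1 v)).1
  let p : ℕ → X := fun n => Nat.rec u (fun _ q => w q (c q - 1)) n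
  have hp0 : p 0 = u := rfl
  have hps : ∀ n, p (n + 1) = w (p n) (c (p n) - 1) := fun n => rfl
  have hp : ∀ n, n < c u → c (p n) + n = c u ∧ d (p n) ≤ n := by
    intro n
    induction n with
    | zero => intro _; simp [hp0, hu]
    | succ n ih =>
      intro hn
      obtain ⟨e1, e2⟩ := ih (by omega)
      obtain ⟨a1, a2⟩ := hw (p n) (c (p n) - 1) (Finset.mem_Ico.2 ⟨by omega, by omega⟩)
      have := hd _ _ a1
      rw [← hps] at a2 this
      constructor <;> omega
  let W : Set X := {v | c v + d v < c u ∨ ∃ n, n < c u ∧ v = p n}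
  have hWr : ∀ v ∈ W, d v = r → v = p r := by
    rintro v (hv | ⟨n, hn, rfl⟩) hr
    · have := hpos v; omega
    · have := hp n hn
      have : n = r := by omega
      rw [this]
  have hWA : ∀ x ∈ W, ∀ y ∈ W, x ≠ y → (A.Adj x y ↔ B.Adj x y) := by
    intro x hx y hy hxy
    apply hAB
    rintro ⟨e1, e2⟩
    exact hxy ((hWr x hx e1).trans (hWr y hy e2).symm)
  suffices H : ∃ c' k', IsGrundyColoring B c' k' ∧ ∀ v ∈ W, c' v = c v by
    obtain ⟨c', k', hc', he⟩ := H
    exact ⟨c', k', hc', he u (Or.inr ⟨0, hpos u, rfl⟩)⟩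
  apply extend_grundy B _ W c rfl (fun v _ => hpos v)
  · intro x hx y hy hxy
    exact h2 ((hWA x hx y hy hxy.ne).2 hxy)
  · intro v hv i hi1 hi2
    have key : ∃ z ∈ W, A.Adj v z ∧ c z = i := by
      obtain ⟨a1, a2⟩ := hw v i (Finset.mem_Ico.2 ⟨hi1, hi2⟩)
      have a3 := hd _ _ a1
      refine ⟨w v i, ?_, a1, a2⟩
      rcases hv with hv | ⟨n, hn, rfl⟩
      · left; omega
      · obtain ⟨e1, e2⟩ := hp n hn
        by_cases hi : i = c (p n) - 1
        · right
          refine ⟨n + 1, by omega, ?_⟩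
          rw [hps, hi]
        · left; omega
    obtain ⟨z, hz, hadj, hcz⟩ := key
    exact ⟨z, hz, (hWA v hv z hz hadj.ne).1 hadj, hcz⟩

lemma deg_lower {V : Type*} [Fintype V] (G : SimpleGraph V) (s : Set V)
    (A : SimpleGraph s) (hA : A ≤ G.induce s) (v : s) (S : Finset ℕ) (c : s → ℕ)
    (h : ∀ i ∈ S, ∃ w, A.Adj v w ∧ c w = i) : S.card ≤ deg G v := by
  classical
  have : Nonempty s := ⟨v⟩
  choose! f hf using h
  have : (↑(S.image (fun i => f i)) : Set s).ncard = S.card := by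
    rw [Set.ncard_coe_finset, Finset.card_image_of_injOn]
    intro a ha b hb hab
    rw [← (hf a ha).2, ← (hf b hb).2]
    exact congrArg c hab
  rw [← this, ← Set.ncard_image_of_injective _ Subtype.val_injective]
  apply Set.ncard_le_ncard _ (Set.toFinite _)
  rintro _ ⟨x, hx, rfl⟩
  simp only [Finset.coe_image, Set.mem_image] at hx
  obtain ⟨i, hi, rfl⟩ := hx
  exact hA (hf i hi).1

lemma deg_le_card {V : Type*} [Fintype V] (G : SimpleGraph V) (v : V) :
    deg G v ≤ Fintype.card V := by
  unfold deg
  rw [← Nat.card_eq_fintype_card, ← Set.ncard_univ]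
  exact Set.ncard_le_ncard (Set.subset_univ _) (Set.toFinite _)

lemma le_delta2 {V : Type*} [Fintype V] (G : SimpleGraph V) (u : V) :
    maxSmallNbrDeg G u ≤ delta2 G := by
  refine le_csSup ?_ (show _ ∈ {d | ∃ u, maxSmallNbrDeg G u = d} from ⟨u, rfl⟩)
  exact (Set.finite_range (maxSmallNbrDeg G)).bddAbove

lemma le_delta2_of_adj {V : Type*} [Fintype V] (G : SimpleGraph V) (a b : V) (hab : G.Adj a b)
    (h : deg G b ≤ deg G a) : deg G b ≤ delta2 G := by
  refine le_trans ?_ (le_delta2 G a)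
  refine le_csSup ?_ (show _ ∈ {d | ∃ v, G.Adj a v ∧ deg G v ≤ deg G a ∧ deg G v = d} from
    ⟨b, hab, h, rfl⟩)
  refine ⟨Fintype.card V, ?_⟩
  rintro _ ⟨v, -, -, rfl⟩
  exact deg_le_card G v

lemma color_bound {V : Type*} [Fintype V] (G : SimpleGraph V) (s : Set V)
    (A : SimpleGraph s) (hA : A ≤ G.induce s) (u : s) (c : s → ℕ) (k : ℕ)
    (hc : IsGrundyColoring A c k) : c u ≤ delta2 G + 1 := by
  obtain ⟨h1, h2, -, h4⟩ := hc
  by_cases hj : c u ≤ 1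
  · omega
  obtain ⟨v, huv, hv⟩ := h4 u (c u - 1) (Finset.mem_Ico.2 ⟨by omega, by omega⟩)
  have d1 := deg_lower G s A hA u _ c (h4 u)
  have d2 : (insert (c u) (Finset.Ico 1 (c v))).card ≤ deg G v := by
    apply deg_lower G s A hA v _ c
    intro i hi
    rcases Finset.mem_insert.1 hi with rfl | hi
    · exact ⟨u, huv.symm, rfl⟩
    · exact h4 v i hi
  rw [Finset.card_insert_of_notMem (by simp; omega)] at d2
  simp only [Nat.card_Ico] at d1 d2
  have hadj : G.Adj u v := hA huv
  rcases le_total (deg G u) (deg G v) with h | h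
  · have := le_delta2_of_adj G v u hadj.symm h
    omega
  · have := le_delta2_of_adj G u v hadj h
    omega

lemma ball_dist_le {V : Type*} (G : SimpleGraph V) (u : V) (r : ℕ) (x : gball G u r) :
    (G.induce (gball G u r)).dist ⟨u, mem_gball_self G u r⟩ x ≤ r := by
  classical
  obtain ⟨x, hx, hr⟩ := x
  obtain ⟨p, hp⟩ := hx.exists_walk_length_eq_dist
  have hs : ∀ y ∈ p.support, y ∈ gball G u r := by
    intro y hy
    refine ⟨⟨p.takeUntil y hy⟩, ?_⟩
    have := dist_le (p.takeUntil y hy)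
    have := p.length_takeUntil_le_length hy
    omega
  have h := dist_le (p.induce (gball G u r) hs)
  have h2 : (p.induce (gball G u r) hs).length = p.length := by
    rw [← Walk.length_map (Embedding.induce _).toHom, Walk.map_induce]
    rfl
  have : (p.induce (gball G u r) hs).length ≤ r := by omega
  exact le_trans h this

lemma nontree_cycle {V : Type*} (G : SimpleGraph V) (s : Set V) (T : SimpleGraph s)
    (hle : T ≤ G.induce s) (hTree : T.IsTree) (D : ℕ)
    (hgirth : ∀ (v : V) (cyc : G.Walk v v), cyc.IsCycle → D ≤ cyc.length)
    (u x y : s) (hG : G.Adj x y) (hT : ¬ T.Adj x y) : D ≤ T.dist u x + T.dist u y + 1 := by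
  classical
  obtain ⟨p, hp, hpl⟩ := hTree.connected.exists_path_of_dist y x
  let q := (p.mapLe hle)
  have hq : q.IsPath := hp.mapLe hle
  have hxy : (G.induce s).Adj x y := hG
  have hcyc : (Walk.cons hxy q).IsCycle := by
    rw [Walk.cons_isCycle_iff]
    refine ⟨hq, ?_⟩
    intro hmem
    simp only [q, Walk.edges_mapLe_eq_edges] at hmem
    exact hT (p.adj_of_mem_edges hmem)
  have hc2 := hcyc.map (f := (Embedding.induce (G := G) s).toHom) Subtype.val_injective
  have := hgirth _ _ hc2
  rw [Walk.length_map, Walk.length_cons] at this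
  have hql : q.length = T.dist y x := by simp [q, hpl]
  have htri := hTree.connected.dist_triangle (u := y) (v := u) (w := x)
  rw [T.dist_comm (u := y) (v := u)] at htri
  omega

lemma statement_aux {V : Type*} [Fintype V] (G : SimpleGraph V)
    (hgirth : ∀ (v : V) (cyc : G.Walk v v), cyc.IsCycle → 2 * delta2 G + 1 ≤ cyc.length)
    (u : V) (r : ℕ) (hrD : r ≤ delta2 G) (T : SimpleGraph ↥(gball G u (r)))
    (hle : T ≤ G.induce (gball G u (r)))
    (hTree : T.IsTree)
    (hBFS : ∀ v, T.dist ⟨u, mem_gball_self G u _⟩ v =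
      (G.induce (gball G u (r))).dist ⟨u, mem_gball_self G u _⟩ v) :
    grundyAt (G.induce (gball G u (r))) ⟨u, mem_gball_self G u _⟩ =
      grundyAt T ⟨u, mem_gball_self G u _⟩ := by
  classical
  have hdr : ∀ x, T.dist ⟨u, mem_gball_self G u r⟩ x ≤ r := by
    intro x
    rw [hBFS]
    exact ball_dist_le G u r x
  have hext : ∀ x y : ↥(gball G u r), G.Adj x y → ¬ T.Adj x y →
      T.dist ⟨u, mem_gball_self G u r⟩ x = delta2 G ∧
      T.dist ⟨u, mem_gball_self G u r⟩ y = delta2 G := by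
    intro x y h1 h2
    have := nontree_cycle G _ T hle hTree _ hgirth ⟨u, mem_gball_self G u r⟩ x y h1 h2
    have := hdr x
    have := hdr y
    constructor <;> omega
  have hiff : ∀ x y, ¬ (T.dist ⟨u, mem_gball_self G u r⟩ x = delta2 G ∧
      T.dist ⟨u, mem_gball_self G u r⟩ y = delta2 G) →
      ((G.induce (gball G u r)).Adj x y ↔ T.Adj x y) := by
    intro x y h
    refine ⟨fun hG => ?_, fun hT => hle hT⟩
    by_contra hT
    exact h (hext x y hG hT)
  have hd : ∀ x y, (G.induce (gball G u r)).Adj x y →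
      T.dist ⟨u, mem_gball_self G u r⟩ y ≤ T.dist ⟨u, mem_gball_self G u r⟩ x + 1 := by
    intro x y h
    rw [hBFS, hBFS]
    have hc : (G.induce (gball G u r)).Connected := hTree.connected.mono hle
    have h1 := hc.dist_triangle (u := ⟨u, mem_gball_self G u r⟩) (v := x) (w := y)
    rw [dist_eq_one_iff_adj.2 h] at h1
    exact h1
  unfold grundyAt
  congr 1
  ext j
  constructor
  · rintro ⟨c, k, hc, rfl⟩
    exact transfer_grundy _ T (fun x => T.dist ⟨u, mem_gball_self G u r⟩ x) (delta2 G)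
      ⟨u, mem_gball_self G u r⟩ (by simp) hd hiff c k hc (color_bound G _ _ le_rfl _ c k hc)
  · rintro ⟨c, k, hc, rfl⟩
    exact transfer_grundy T _ (fun x => T.dist ⟨u, mem_gball_self G u r⟩ x) (delta2 G)
      ⟨u, mem_gball_self G u r⟩ (by simp) (fun x y h => hd x y (hle h)) (fun x y h => (hiff x y h).symm) c k hc
      (color_bound G _ _ hle _ c k hc)

/-- If every cycle of `G` has length at least `2Δ₂(G) + 1` and `T` is a BFS
spanning tree of `G(u) = G[B(u, Δ(u))]` rooted at `u`, then `Γ_{G(u)}(u) = Γ_T(u)`. -/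
theorem statement_16 [Fintype V] (G : SimpleGraph V)
    (hgirth : ∀ (v : V) (cyc : G.Walk v v), cyc.IsCycle → 2 * delta2 G + 1 ≤ cyc.length)
    (u : V) (T : SimpleGraph ↥(gball G u (maxSmallNbrDeg G u)))
    (hle : T ≤ G.induce (gball G u (maxSmallNbrDeg G u)))
    (hTree : T.IsTree)
    (hBFS : ∀ v, T.dist ⟨u, mem_gball_self G u _⟩ v =
      (G.induce (gball G u (maxSmallNbrDeg G u))).dist ⟨u, mem_gball_self G u _⟩ v) :
    grundyAt (G.induce (gball G u (maxSmallNbrDeg G u))) ⟨u, mem_gball_self G u _⟩ =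
      grundyAt T ⟨u, mem_gball_self G u _⟩ := by
  exact statement_aux G hgirth u _ (le_delta2 G u) T hle hTree hBFS
end
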